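/- arXiv:2407.05768 — 2 statements merged into one kernel-verified Lean document; each statement's English description precedes it below -/
import Mathlib

section
/- (Theorem 1) For every integer n ≥ 0, D_{−1,n+2}(q) = q^{C(n,2)} d_{0,n+1}(q) · ((q−1)^{n+1}[n+1]_q! − q^{C(n+2,2)}); equivalently, −D_{−1,n+2}(q)/(q^{C(n,2)} d_{0,n+1}(q)) = r_{1,n}(q) where r_{1,n}(q) = q^{C(n+2,2)} − (q−1)^{n+1}[n+1]_q!. -/
open Polynomial Finset

noncomputable section

/-- `C2 m` is the binomial coefficient `C(m,2) = m(m-1)/2` for `m : ℤ`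
(a nonnegative integer for every integer `m`). -/
def C2 (m : ℤ) : ℕ := (m * (m - 1) / 2).toNat

/-- The q-integer `[n]_q = 1 + q + ⋯ + q^{n-1}` in `ℤ[q]` (with `q = X`). -/
def qInt (n : ℕ) : Polynomial ℤ := ∑ i ∈ Finset.range n, X ^ i

/-- The q-factorial `[n]_q! = [1]_q [2]_q ⋯ [n]_q`, with `[0]_q! = 1`. -/
def qFact : ℕ → Polynomial ℤ
  | 0 => 1
  | n + 1 => qFact n * qInt (n + 1)

/-- `a(n,q) = q^{C(n,2)}` for `n ≥ 0` and `a(n,q) = 0` for `n < 0`. -/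
def a (m : ℤ) : Polynomial ℤ := if m < 0 then 0 else X ^ C2 m

/-- The Hankel determinant `d_{m,n}(q) = det(q^{C(m+i+j,2)})_{i,j=0}^{n-1}`. -/
def dd (m : ℤ) (n : ℕ) : Polynomial ℤ :=
  Matrix.det (Matrix.of fun i j : Fin n => (X : Polynomial ℤ) ^ C2 (m + (i : ℤ) + (j : ℤ)))

/-- The Hankel determinant `D_{m,n}(q) = det(a(m+i+j,q))_{i,j=0}^{n-1}`. -/
def DD (m : ℤ) (n : ℕ) : Polynomial ℤ :=
  Matrix.det (Matrix.of fun i j : Fin n => a (m + (i : ℤ) + (j : ℤ)))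

/-- `v_{k,n}(q) = det(a(k-n+i+j,q))_{i,j=0}^{n-1}`. -/
def vv (k : ℤ) (n : ℕ) : Polynomial ℤ :=
  Matrix.det (Matrix.of fun i j : Fin n => a (k - (n : ℤ) + (i : ℤ) + (j : ℤ)))

/-- `r_{1,n}(q) = q^{C(n+2,2)} - (q-1)^{n+1} [n+1]_q!`. -/
def r1 (n : ℕ) : Polynomial ℤ := X ^ ((n + 2).choose 2) - (X - 1) ^ (n + 1) * qFact (n + 1)

/-- `r_{2,n}(q)`, defined by `r_{2,0} = 1` and
`r_{2,n} = r_{1,n}^2 + (q^{n+1}-1) q^{n+2} r_{2,n-1}` for `n ≥ 1`. -/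
def r2 : ℕ → Polynomial ℤ
  | 0 => 1
  | n + 1 => (r1 (n + 1)) ^ 2 + (X ^ (n + 2) - 1) * X ^ (n + 3) * r2 n

theorem two_mul_C2 (m : ℤ) : 2 * (C2 m : ℤ) = m * (m - 1) := by
  have hdvd : (2 : ℤ) ∣ m * (m - 1) := by
    simpa using (Int.even_mul_pred_self m).two_dvd
  have hnonneg : 0 ≤ m * (m - 1) := by
    rcases le_or_gt m 0 with h | h <;> nlinarith
  unfold C2
  rw [Int.toNat_of_nonneg (by positivity)]
  exact Int.mul_ediv_cancel' hdvd

theorem two_mul_choose_two (n : ℕ) : 2 * ((n.choose 2 : ℕ) : ℤ) = n * (n - 1) := by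
  induction n with
  | zero => simp
  | succ n ih =>
    rw [Nat.choose_succ_succ' n 1, Nat.choose_one_right]
    push_cast
    linarith

theorem det_mul_row_mul_column {R : Type*} [CommRing R] {n : ℕ} (u v : Fin n → R)
    (M : Matrix (Fin n) (Fin n) R) :
    Matrix.det (Matrix.of fun i j => u i * (v j * M i j)) = (∏ i, u i) * ((∏ j, v j) * M.det) := by
  rw [← Matrix.det_mul_row v M, ← Matrix.det_mul_column u]
  rfl

/-- The product `∏_{i<n} (q^n - q^i)`. -/
theorem prod_X_pow_sub_X_pow (n : ℕ) :
    ∏ i ∈ Finset.range n, ((X : Polynomial ℤ) ^ n - X ^ i) =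
      X ^ (n.choose 2) * (X - 1) ^ n * qFact n := by
  induction n with
  | zero => simp [qFact]
  | succ n ih =>
    have hshift : ∀ i ∈ Finset.range n,
        (X : Polynomial ℤ) ^ (n + 1) - X ^ (i + 1) = X * (X ^ n - X ^ i) := by
      intro i _
      ring
    have hgeom : (X : Polynomial ℤ) ^ (n + 1) - 1 = qInt (n + 1) * (X - 1) :=
      (geom_sum_mul X (n + 1)).symm
    rw [Finset.prod_range_succ', Finset.prod_congr rfl hshift, Finset.prod_mul_distrib, ih,
      pow_zero, hgeom, Nat.choose_succ_succ' n 1, Nat.choose_one_right, qFact]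
    simp only [Finset.prod_const, Finset.card_range]
    ring

theorem det_vandermonde_succ_last {R : Type*} [CommRing R] (v : ℕ → R) (n : ℕ) :
    (Matrix.vandermonde fun i : Fin (n + 1) => v i).det =
      (Matrix.vandermonde fun i : Fin n => v i).det * ∏ i ∈ Finset.range n, (v n - v i) := by
  have hIoi : ∀ (k : ℕ) (i : Fin k), Finset.Ioi i = Finset.univ.filter (i < ·) := by
    intro k i
    ext j
    simp
  simp only [Matrix.det_vandermonde, hIoi, Finset.prod_filter]
  simp [Fin.prod_univ_castSucc, Finset.prod_mul_distrib, Finset.prod_range, Fin.le_last,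
    not_lt_of_ge]

theorem dd_zero_eq_vandermonde (n : ℕ) :
    dd 0 n = X ^ (2 * ∑ i ∈ Finset.range n, i.choose 2) *
      (Matrix.vandermonde fun i : Fin n => (X : Polynomial ℤ) ^ (i : ℕ)).det := by
  have hentry : (Matrix.of fun i j : Fin n => (X : Polynomial ℤ) ^ C2 (0 + (i : ℤ) + (j : ℤ))) =
      Matrix.of fun i j : Fin n => X ^ ((i : ℕ).choose 2) * (X ^ ((j : ℕ).choose 2) *
        Matrix.vandermonde (fun i : Fin n => (X : Polynomial ℤ) ^ (i : ℕ)) i j) := by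
    ext1 i j
    simp only [Matrix.of_apply, Matrix.vandermonde_apply, ← pow_mul, ← pow_add]
    congr 1
    have h1 := two_mul_C2 (0 + (i : ℤ) + (j : ℤ))
    have h2 := two_mul_choose_two i
    have h3 := two_mul_choose_two j
    zify
    linarith
  rw [dd, hentry, det_mul_row_mul_column, Finset.prod_pow_eq_pow_sum,
    Finset.sum_range fun i => i.choose 2]
  ring

theorem dd_zero_succ (n : ℕ) :
    dd 0 (n + 1) = X ^ (3 * n.choose 2) * (X - 1) ^ n * qFact n * dd 0 n := by
  rw [dd_zero_eq_vandermonde, dd_zero_eq_vandermonde,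
    det_vandermonde_succ_last (fun i => (X : Polynomial ℤ) ^ i), prod_X_pow_sub_X_pow,
    Finset.sum_range_succ]
  ring

theorem sum_fin_val (n : ℕ) : ∑ i : Fin n, (i : ℕ) = n.choose 2 := by
  rw [← Finset.sum_range fun i => i, Finset.sum_range_id, Nat.choose_two_right]

theorem dd_one (n : ℕ) : dd 1 n = X ^ (2 * n.choose 2) * dd 0 n := by
  have hentry : (Matrix.of fun i j : Fin n => (X : Polynomial ℤ) ^ C2 (1 + (i : ℤ) + (j : ℤ))) =
      Matrix.of fun i j : Fin n => X ^ (i : ℕ) * (X ^ (j : ℕ) *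
        (Matrix.of fun i j : Fin n => (X : Polynomial ℤ) ^ C2 (0 + (i : ℤ) + (j : ℤ))) i j) := by
    ext1 i j
    simp only [Matrix.of_apply, ← pow_add]
    congr 1
    have h1 := two_mul_C2 (1 + (i : ℤ) + (j : ℤ))
    have h2 := two_mul_C2 (0 + (i : ℤ) + (j : ℤ))
    zify
    linarith
  rw [dd, hentry, det_mul_row_mul_column, Finset.prod_pow_eq_pow_sum, sum_fin_val, ← dd]
  ring

theorem dd_neg_one (n : ℕ) : X ^ (2 * n.choose 2) * dd (-1) n = X ^ n * dd 0 n := by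
  have hentry : (Matrix.of fun i j : Fin n => X ^ (i : ℕ) * (X ^ (j : ℕ) *
        (Matrix.of fun i j : Fin n => (X : Polynomial ℤ) ^ C2 (-1 + (i : ℤ) + (j : ℤ))) i j)) =
      (X : Polynomial ℤ) • Matrix.of fun i j : Fin n => X ^ C2 (0 + (i : ℤ) + (j : ℤ)) := by
    ext1 i j
    simp only [Matrix.of_apply, Matrix.smul_apply, smul_eq_mul, ← pow_add, ← pow_succ']
    congr 1
    have h1 := two_mul_C2 (-1 + (i : ℤ) + (j : ℤ))
    have h2 := two_mul_C2 (0 + (i : ℤ) + (j : ℤ))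
    zify
    linarith
  have hdet := congrArg Matrix.det hentry
  rw [det_mul_row_mul_column, Finset.prod_pow_eq_pow_sum, sum_fin_val, ← dd,
    Matrix.det_smul, ← dd, Fintype.card_fin] at hdet
  rw [← hdet]
  ring

theorem a_of_nonneg {m : ℤ} (hm : 0 ≤ m) : a m = X ^ C2 m := if_neg hm.not_gt

/-- `D_{-1,n+1}` and `d_{-1,n+1}` differ only in the top left entry. -/
theorem DD_neg_one_succ (n : ℕ) : DD (-1) (n + 1) = dd (-1) (n + 1) - X * dd 1 n := by
  have hminor : ∀ j : Fin (n + 1),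
      (Matrix.of fun i j : Fin (n + 1) => a (-1 + (i : ℤ) + (j : ℤ))).submatrix
          Fin.succ j.succAbove =
        (Matrix.of fun i j : Fin (n + 1) =>
          (X : Polynomial ℤ) ^ C2 (-1 + (i : ℤ) + (j : ℤ))).submatrix Fin.succ j.succAbove := by
    intro j
    ext1 i k
    simp only [Matrix.submatrix_apply, Matrix.of_apply]
    apply a_of_nonneg
    push_cast [Fin.val_succ]
    omega
  have hcorner : (Matrix.of fun i j : Fin (n + 1) =>
      (X : Polynomial ℤ) ^ C2 (-1 + (i : ℤ) + (j : ℤ))).submatrix Fin.succ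
        (Fin.succAbove 0) =
      Matrix.of fun i j : Fin n => X ^ C2 (1 + (i : ℤ) + (j : ℤ)) := by
    ext1 i j
    simp only [Matrix.submatrix_apply, Matrix.of_apply, Fin.succAbove_zero, Fin.val_succ]
    congr 2
    push_cast
    ring
  have hrow : ∀ j : Fin n, a (-1 + (((0 : Fin (n + 1)) : ℕ) : ℤ) + ((j.succ : ℕ) : ℤ)) =
      X ^ C2 (-1 + (((0 : Fin (n + 1)) : ℕ) : ℤ) + ((j.succ : ℕ) : ℤ)) := by
    intro j
    apply a_of_nonneg
    push_cast [Fin.val_succ, Fin.val_zero]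
    omega
  rw [DD, dd, dd, Matrix.det_succ_row_zero, Matrix.det_succ_row_zero]
  simp only [hminor]
  rw [Fin.sum_univ_succ, Fin.sum_univ_succ, hcorner]
  simp only [Matrix.of_apply, hrow]
  have ha : a (-1) = 0 := if_pos (by norm_num)
  have hC : C2 (-1) = 1 := by decide
  simp [ha, hC]

/-- Theorem 1:
`D_{-1,n+2}(q) = q^{C(n,2)} d_{0,n+1}(q) ((q-1)^{n+1}[n+1]_q! - q^{C(n+2,2)})`,
i.e. `-D_{-1,n+2}(q)/(q^{C(n,2)} d_{0,n+1}(q)) = r_{1,n}(q)`. -/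
theorem stmt2 (n : ℕ) :
    DD (-1) (n + 2) =
      X ^ (n.choose 2) * dd 0 (n + 1) *
        ((X - 1) ^ (n + 1) * qFact (n + 1) - X ^ ((n + 2).choose 2)) := by
  have hX : (X : Polynomial ℤ) ^ (2 * (n + 2).choose 2) ≠ 0 := pow_ne_zero _ X_ne_zero
  apply mul_left_cancel₀ hX
  rw [DD_neg_one_succ, mul_sub, dd_neg_one, dd_zero_succ, dd_one]
  have h1 : (n + 1).choose 2 = n + n.choose 2 := by
    rw [Nat.choose_succ_succ' n 1, Nat.choose_one_right]
  have h2 : (n + 2).choose 2 = n + 1 + (n + 1).choose 2 := by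
    rw [Nat.choose_succ_succ' (n + 1) 1, Nat.choose_one_right]
  rw [h2, h1]
  ring
end
end

section
/- For all integers k ≥ 1 and n ≥ 0, v_{k,n+k}(q) = (−1)^{k−1+C(n+1,2)} · det(u(i+j+n+2, q))_{i,j=0}^{k−2}, where the right-hand side is a (k−1)×(k−1) determinant (equal to 1 when k = 1). -/
open Polynomial Finset

noncomputable section

/-- An anti-triangular Hankel matrix with unit antidiagonal has determinant `±1`. -/
theorem det_antitriangular_hankel {R : Type*} [CommRing R] (f : ℤ → R)
    (hneg : ∀ m < 0, f m = 0) (hzero : f 0 = 1) (M : ℕ) :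
    Matrix.det (Matrix.of fun i j : Fin M => f ((i : ℤ) + j + 1 - M)) = (-1) ^ M.choose 2 := by
  induction M with
  | zero => simp
  | succ M ih =>
    rw [Matrix.det_succ_row_zero, Finset.sum_eq_single (Fin.last M)]
    · have hsub : (Matrix.of fun i j : Fin (M + 1) =>
          f ((i : ℤ) + j + 1 - (M + 1 : ℕ))).submatrix Fin.succ (Fin.last M).succAbove =
          Matrix.of fun i j : Fin M => f ((i : ℤ) + j + 1 - M) := by
        ext i j
        simp only [Matrix.submatrix_apply, Matrix.of_apply, Fin.succAbove_last, Fin.val_succ,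
          Fin.val_castSucc]
        congr 1
        push_cast
        ring
      rw [hsub, ih, Nat.choose_succ_succ' M 1, Nat.choose_one_right, pow_add]
      simp [hzero]
    · intro j _ hj
      have hlt : (j : ℕ) < M := Fin.val_lt_last hj
      rw [Matrix.of_apply, hneg _ (by simp; omega)]
      simp
    · simp

/-- If `u` is the convolution inverse of `f`, then the reversed Hankel matrices of `f` and `u` are
inverse to each other. -/
theorem sum_hankel_mul_inverse {R : Type*} [CommRing R] (f : ℤ → R)
    (hneg : ∀ m < 0, f m = 0) (hzero : f 0 = 1) (u : ℕ → R) (hu0 : u 0 = 1)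
    (hu : ∀ n : ℕ, 1 ≤ n → ∑ j ∈ Finset.range (n + 1), f j * u (n - j) = 0)
    (M i l : ℕ) (hi : i < M) (hl : l < M) :
    ∑ j ∈ Finset.range M, f ((i : ℤ) + j + 1 - M) *
      (if j + l < M then u (M - 1 - j - l) else 0) = if i = l then 1 else 0 := by
  rcases lt_or_ge i l with h | h
  · rw [if_neg h.ne]
    refine Finset.sum_eq_zero fun j _ => ?_
    split_ifs with hjl
    · rw [hneg _ (by omega), zero_mul]
    · rw [mul_zero]
  · obtain ⟨d, rfl⟩ := Nat.exists_eq_add_of_le h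
    have hsum : ∑ j ∈ Finset.range M, f (((l + d : ℕ) : ℤ) + j + 1 - M) *
        (if j + l < M then u (M - 1 - j - l) else 0) =
        ∑ t ∈ Finset.range (d + 1), f t * u (d - t) := by
      have hsub : Finset.Ico (M - 1 - (l + d)) (M - l) ⊆ Finset.range M := by
        intro j hj
        simp only [Finset.mem_Ico, Finset.mem_range] at hj ⊢
        omega
      rw [← Finset.sum_subset hsub, Finset.sum_Ico_eq_sum_range]
      · rw [show M - l - (M - 1 - (l + d)) = d + 1 by omega]
        refine Finset.sum_congr rfl fun t ht => ?_
        rw [Finset.mem_range] at ht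
        rw [if_pos (by omega)]
        congr 2 <;> omega
      · intro j _ hj
        simp only [Finset.mem_Ico, not_and, not_lt] at hj
        split_ifs with hjl
        · rw [hneg _ (by omega), zero_mul]
        · rw [mul_zero]
    rw [hsum]
    rcases Nat.eq_zero_or_pos d with rfl | hd
    · simp [hzero, hu0]
    · rw [hu d hd, if_neg (by omega)]

/-- Jacobi's complementary minor identity, for a block matrix with vanishing upper left block. -/
theorem det_fromBlocks_zero_mul_det_of_mul_eq_one {R m n : Type*} [CommRing R] [Fintype m]
    [DecidableEq m] [Fintype n] [DecidableEq n] (B : Matrix m n R) (C : Matrix n m R)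
    (D : Matrix n n R) (A' : Matrix m m R) (B' : Matrix m n R) (C' : Matrix n m R)
    (D' : Matrix n n R)
    (h : Matrix.fromBlocks 0 B C D * Matrix.fromBlocks A' B' C' D' = 1) :
    (Matrix.fromBlocks 0 B C D).det * A'.det = D.det := by
  rw [Matrix.fromBlocks_multiply, ← Matrix.fromBlocks_one, Matrix.fromBlocks_inj] at h
  have hmul : Matrix.fromBlocks 0 B C D * Matrix.fromBlocks A' 0 C' 1 =
      Matrix.fromBlocks 1 B 0 D := by
    rw [Matrix.fromBlocks_multiply, h.1, h.2.2.1]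
    simp
  simpa [Matrix.det_fromBlocks_zero₂₁, Matrix.det_fromBlocks_zero₁₂] using
    congrArg Matrix.det hmul

/-- Hankel determinants of a sequence, extended by zero to negative indices, expressed through
Hankel determinants of its convolution inverse. -/
theorem det_hankel_eq_det_hankel_inverse {R : Type*} [CommRing R] (f : ℤ → R)
    (hneg : ∀ m < 0, f m = 0) (hzero : f 0 = 1) (u : ℕ → R) (hu0 : u 0 = 1)
    (hu : ∀ n : ℕ, 1 ≤ n → ∑ j ∈ Finset.range (n + 1), f j * u (n - j) = 0) (r n : ℕ) :
    Matrix.det (Matrix.of fun i j : Fin (n + (r + 1)) => f ((i : ℤ) + j - n)) =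
      (-1) ^ (n + 1 + 2 * r).choose 2 *
        Matrix.det (Matrix.of fun i j : Fin r => u ((i : ℕ) + (j : ℕ) + n + 2)) := by
  let M := r + (n + (r + 1))
  let e : Fin r ⊕ Fin (n + (r + 1)) ≃ Fin M := finSumFinEquiv
  let K : Matrix (Fin M) (Fin M) R := Matrix.of fun i j => f ((i : ℤ) + j + 1 - M)
  let L : Matrix (Fin M) (Fin M) R :=
    Matrix.of fun j l => if (j : ℕ) + l < M then u (M - 1 - j - l) else 0
  have hKL : K * L = 1 := by
    ext i l
    rw [Matrix.mul_apply, Matrix.one_apply]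
    simp only [K, L, Matrix.of_apply]
    rw [Fin.sum_univ_eq_sum_range (fun j : ℕ => f ((i : ℤ) + j + 1 - M) *
      (if j + (l : ℕ) < M then u (M - 1 - j - l) else 0)) M,
      sum_hankel_mul_inverse f hneg hzero u hu0 hu M i l i.2 l.2]
    simp [Fin.ext_iff]
  have hblock : (K.submatrix e e).toBlocks₁₁ = 0 := by
    ext i j
    simp only [K, e, M, Matrix.toBlocks₁₁, Matrix.of_apply, Matrix.submatrix_apply,
      finSumFinEquiv_apply_left, Fin.val_castAdd, Matrix.zero_apply]
    exact hneg _ (by omega)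
  have hK : K.submatrix e e = Matrix.fromBlocks 0 (K.submatrix e e).toBlocks₁₂
      (K.submatrix e e).toBlocks₂₁ (K.submatrix e e).toBlocks₂₂ := by
    rw [← hblock, Matrix.fromBlocks_toBlocks]
  have hone : Matrix.fromBlocks 0 (K.submatrix e e).toBlocks₁₂
      (K.submatrix e e).toBlocks₂₁ (K.submatrix e e).toBlocks₂₂ *
      Matrix.fromBlocks (L.submatrix e e).toBlocks₁₁ (L.submatrix e e).toBlocks₁₂
        (L.submatrix e e).toBlocks₂₁ (L.submatrix e e).toBlocks₂₂ = 1 := by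
    rw [← hK, Matrix.fromBlocks_toBlocks, Matrix.submatrix_mul_equiv, hKL,
      Matrix.submatrix_one_equiv]
  have hdet := det_fromBlocks_zero_mul_det_of_mul_eq_one _ _ _ _ _ _ _ hone
  rw [← hK, Matrix.det_submatrix_equiv_self, det_antitriangular_hankel f hneg hzero] at hdet
  have hH : (K.submatrix e e).toBlocks₂₂ =
      Matrix.of fun i j : Fin (n + (r + 1)) => f ((i : ℤ) + j - n) := by
    ext i j
    simp only [K, e, M, Matrix.toBlocks₂₂, Matrix.of_apply, Matrix.submatrix_apply,
      finSumFinEquiv_apply_right, Fin.val_natAdd]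
    congr 1
    push_cast
    ring
  have hU : (L.submatrix e e).toBlocks₁₁ =
      (Matrix.of fun i j : Fin r => u ((i : ℕ) + (j : ℕ) + n + 2)).submatrix
        Fin.revPerm Fin.revPerm := by
    ext i j
    simp only [L, e, M, Matrix.toBlocks₁₁, Matrix.of_apply, Matrix.submatrix_apply,
      finSumFinEquiv_apply_left, Fin.val_castAdd, Fin.revPerm_apply, Fin.val_rev]
    rw [if_pos (by omega)]
    congr 1
    omega
  rw [hH, hU, Matrix.det_submatrix_equiv_self] at hdet
  rw [← hdet]
  congr 2
  simp only [M]
  congr 1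
  omega

theorem neg_one_pow_choose_two_add_two_mul {R : Type*} [CommRing R] (m r : ℕ) :
    (-1 : R) ^ (m + 2 * r).choose 2 = (-1) ^ (r + m.choose 2) := by
  induction r with
  | zero => simp
  | succ r ih =>
    rw [show m + 2 * (r + 1) = m + 2 * r + 1 + 1 by ring, Nat.choose_succ_succ' _ 1,
      Nat.choose_succ_succ' _ 1, Nat.choose_one_right, Nat.choose_one_right,
      show m + 2 * r + 1 + (m + 2 * r + (m + 2 * r).choose 2) =
        2 * (m + 2 * r) + 1 + (m + 2 * r).choose 2 by ring, pow_add, ih, add_right_comm r 1]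
    simp [pow_add, pow_mul, mul_comm]

theorem a_of_neg {m : ℤ} (hm : m < 0) : a m = 0 := if_pos hm

theorem a_natCast (m : ℕ) : a m = X ^ m.choose 2 := by
  rw [a, if_neg (by omega), C2, Nat.choose_two_right]
  congr 1
  rcases m with _ | m
  · rfl
  · push_cast
    rw [add_sub_cancel_right]
    exact mod_cast Int.toNat_natCast ((m + 1) * m / 2)

/-- `v_{k,n+k}(q) = (-1)^{k-1+C(n+1,2)} det(u(i+j+n+2,q))_{i,j=0}^{k-2}` for `k ≥ 1`. -/
theorem stmt15 (u : ℕ → Polynomial ℤ) (hu0 : u 0 = 1)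
    (hu : ∀ n : ℕ, 1 ≤ n → ∑ j ∈ Finset.range (n + 1), X ^ (j.choose 2) * u (n - j) = 0)
    (k n : ℕ) (hk : 1 ≤ k) :
    vv (k : ℤ) (n + k) =
      (-1) ^ (k - 1 + (n + 1).choose 2) *
        Matrix.det (Matrix.of fun i j : Fin (k - 1) => u ((i : ℕ) + (j : ℕ) + n + 2)) := by
  obtain ⟨r, rfl⟩ := Nat.exists_eq_add_of_le' hk
  have h := det_hankel_eq_det_hankel_inverse a (fun _ => a_of_neg) (by simpa using a_natCast 0)
    u hu0 (by simpa only [a_natCast] using hu) r n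
  rw [neg_one_pow_choose_two_add_two_mul] at h
  rw [Nat.add_sub_cancel, ← h, vv]
  refine congrArg Matrix.det (Matrix.ext fun i j => congrArg a ?_)
  push_cast
  ring
end
end
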